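/- arXiv:1409.1400 — 5 statements merged into one kernel-verified Lean document; each statement's English description precedes it below -/
import Mathlib

section
/- For x : Fin 4 → ℝ let H(x) be the 2×2 complex matrix with rows (x₀+x₃, x₁−i x₂) and (x₁+i x₂, x₀−x₃). Then for every A in the special linear group SL(2,ℂ) and every x : Fin 4 → ℝ there exists y : Fin 4 → ℝ such that A · H(x) · Aᴴ = H(y) and y₀² − y₁² − y₂² − y₃² = x₀² − x₁² − x₂² − x₃², where Aᴴ denotes the conjugate transpose of A. -/
open Matrix

/-- The van der Waerden parametrization of Minkowski vectors by 2×2 Hermitian matrices. -/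
noncomputable def vdwMatrix (x : Fin 4 → ℝ) : Matrix (Fin 2) (Fin 2) ℂ :=
  !![(x 0 : ℂ) + (x 3 : ℂ), (x 1 : ℂ) - Complex.I * (x 2 : ℂ);
     (x 1 : ℂ) + Complex.I * (x 2 : ℂ), (x 0 : ℂ) - (x 3 : ℂ)]

theorem vdwMatrix_isHermitian (x : Fin 4 → ℝ) : (vdwMatrix x).IsHermitian := by
  ext i j
  fin_cases i <;> fin_cases j <;>
    simp [vdwMatrix, Matrix.conjTranspose_apply, sub_eq_add_neg]

theorem vdwMatrix_det (x : Fin 4 → ℝ) :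
    (vdwMatrix x).det = ((x 0 ^ 2 - x 1 ^ 2 - x 2 ^ 2 - x 3 ^ 2 : ℝ) : ℂ) := by
  simp only [vdwMatrix, Matrix.det_fin_two_of]
  push_cast
  linear_combination (x 2 : ℂ) ^ 2 * Complex.I_sq

theorem exists_vdwMatrix_eq (M : Matrix (Fin 2) (Fin 2) ℂ) (hM : M.IsHermitian) :
    ∃ y : Fin 4 → ℝ, M = vdwMatrix y := by
  have h00 := congrArg Complex.im (hM.apply 0 0)
  have h11 := congrArg Complex.im (hM.apply 1 1)
  have h10r := congrArg Complex.re (hM.apply 1 0)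
  have h10i := congrArg Complex.im (hM.apply 1 0)
  simp at h00 h11 h10r h10i
  refine ⟨![((M 0 0).re + (M 1 1).re) / 2, (M 1 0).re, (M 1 0).im,
    ((M 0 0).re - (M 1 1).re) / 2], ?_⟩
  ext i j
  fin_cases i <;> fin_cases j <;> apply Complex.ext <;> simp [vdwMatrix] <;> linarith

/-- For every `A ∈ SL(2,ℂ)` the map `H(x) ↦ A · H(x) · Aᴴ` sends the Hermitian matrix of a
real four-vector `x` to that of a real four-vector `y` with the same Minkowski quadratic form. -/
theorem sl2C_acts_on_minkowski (A : Matrix.SpecialLinearGroup (Fin 2) ℂ) (x : Fin 4 → ℝ) :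
    ∃ y : Fin 4 → ℝ,
      (A : Matrix (Fin 2) (Fin 2) ℂ) * vdwMatrix x * (A : Matrix (Fin 2) (Fin 2) ℂ)ᴴ =
        vdwMatrix y ∧
      y 0 ^ 2 - y 1 ^ 2 - y 2 ^ 2 - y 3 ^ 2 = x 0 ^ 2 - x 1 ^ 2 - x 2 ^ 2 - x 3 ^ 2 := by
  have hH : ((A : Matrix (Fin 2) (Fin 2) ℂ) * vdwMatrix x *
      (A : Matrix (Fin 2) (Fin 2) ℂ)ᴴ).IsHermitian :=
    Matrix.isHermitian_mul_mul_conjTranspose _ (vdwMatrix_isHermitian x)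
  obtain ⟨y, hy⟩ := exists_vdwMatrix_eq _ hH
  refine ⟨y, hy, ?_⟩
  have hd := congrArg Matrix.det hy
  rw [Matrix.det_mul, Matrix.det_mul, Matrix.det_conjTranspose, A.det_coe, vdwMatrix_det,
    vdwMatrix_det, star_one, one_mul, mul_one] at hd
  exact (Complex.ofReal_injective hd).symm
end

section
/- Let P be a polynomial in four real variables such that P(Λ·p) = P(p) for every p : Fin 4 → ℝ and every matrix Λ in the restricted Lorentz group. Then there exists a polynomial D̃ in one real variable such that P(p) = D̃(p₀² − p₁² − p₂² − p₃²) for all p : Fin 4 → ℝ. -/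
open Matrix

/-- The Minkowski metric matrix `diag(1, −1, −1, −1)`. -/
noncomputable def minkowskiEta : Matrix (Fin 4) (Fin 4) ℝ :=
  Matrix.diagonal ![1, -1, -1, -1]

/-- A null rotation (parabolic Lorentz transformation) fixing `p₀ - p₃`. -/
noncomputable def nullRot (a b : ℝ) : Matrix (Fin 4) (Fin 4) ℝ :=
  !![1 + (a^2+b^2)/2, a, b, -((a^2+b^2)/2);
     a, 1, 0, -a;
     b, 0, 1, -b;
     (a^2+b^2)/2, a, b, 1 - (a^2+b^2)/2]

/-- A boost scaling `p₀ + p₃` by `l` and `p₀ - p₃` by `l⁻¹`. -/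
noncomputable def zBoost (l : ℝ) : Matrix (Fin 4) (Fin 4) ℝ :=
  !![(l + l⁻¹)/2, 0, 0, (l - l⁻¹)/2;
     0, 1, 0, 0;
     0, 0, 1, 0;
     (l - l⁻¹)/2, 0, 0, (l + l⁻¹)/2]

lemma nullRot_metric (a b : ℝ) :
    (nullRot a b)ᵀ * minkowskiEta * nullRot a b = minkowskiEta := by
  ext i j
  fin_cases i <;> fin_cases j <;>
    simp [nullRot, minkowskiEta, Matrix.mul_apply, Fin.sum_univ_four, Matrix.diagonal_apply] <;>
    ring

lemma nullRot_det (a b : ℝ) : (nullRot a b).det = 1 := by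
  simp [nullRot, Matrix.det_succ_row_zero, Fin.sum_univ_succ, Fin.succAbove]
  ring

lemma zBoost_metric (l : ℝ) (hl : 0 < l) :
    (zBoost l)ᵀ * minkowskiEta * zBoost l = minkowskiEta := by
  have h : l * l⁻¹ = 1 := mul_inv_cancel₀ hl.ne'
  ext i j
  fin_cases i <;> fin_cases j <;>
    simp [zBoost, minkowskiEta, Matrix.mul_apply, Fin.sum_univ_four, Matrix.diagonal_apply] <;>
    first | ring1 | linear_combination h | linear_combination -h

lemma zBoost_det (l : ℝ) (hl : 0 < l) : (zBoost l).det = 1 := by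
  have h : l * l⁻¹ = 1 := mul_inv_cancel₀ hl.ne'
  simp [zBoost, Matrix.det_succ_row_zero, Fin.sum_univ_succ, Fin.succAbove]
  linear_combination h

lemma zBoost_zero (l : ℝ) (hl : 0 < l) : 1 ≤ zBoost l 0 0 := by
  have h : l * l⁻¹ = 1 := mul_inv_cancel₀ hl.ne'
  have h2 : 0 < l⁻¹ := inv_pos.mpr hl
  simp only [zBoost, Matrix.of_apply, Matrix.cons_val_zero]
  nlinarith [sq_nonneg (l - l⁻¹)]

lemma nullRot_zero (a b : ℝ) : 1 ≤ nullRot a b 0 0 := by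
  simp only [nullRot, Matrix.of_apply, Matrix.cons_val_zero]
  nlinarith [sq_nonneg a, sq_nonneg b]

lemma to_canonical (p : Fin 4 → ℝ) (hv : 0 < p 0 - p 3) :
    (zBoost (p 0 - p 3)).mulVec
      ((nullRot (-(p 1) / (p 0 - p 3)) (-(p 2) / (p 0 - p 3))).mulVec p) =
    ![((p 0 ^ 2 - p 1 ^ 2 - p 2 ^ 2 - p 3 ^ 2) + 1) / 2, 0, 0,
      ((p 0 ^ 2 - p 1 ^ 2 - p 2 ^ 2 - p 3 ^ 2) - 1) / 2] := by
  have h := hv.ne'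
  ext i
  fin_cases i <;>
    simp [zBoost, nullRot, Matrix.mulVec, dotProduct, Fin.sum_univ_four] <;>
    field_simp <;> ring

/-- The evaluation of a multivariate polynomial along a polynomial curve. -/
lemma eval_curve (P : MvPolynomial (Fin 4) ℝ) (f : Fin 4 → Polynomial ℝ) (t : ℝ) :
    (MvPolynomial.aeval f P).eval t = MvPolynomial.eval (fun i => (f i).eval t) P := by
  induction P using MvPolynomial.induction_on with
  | C a => simp
  | add p q hp hq => simp [hp, hq]
  | mul_X p i hp => simp [hp]

/-- A polynomial in four real variables invariant under the restricted Lorentz group is a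
polynomial in the Minkowski quadratic form `p₀² − p₁² − p₂² − p₃²`. -/
theorem lorentz_invariant_polynomial (P : MvPolynomial (Fin 4) ℝ)
    (hinv : ∀ Λ : Matrix (Fin 4) (Fin 4) ℝ,
      Λᵀ * minkowskiEta * Λ = minkowskiEta → Λ.det = 1 → 1 ≤ Λ 0 0 →
      ∀ p : Fin 4 → ℝ, MvPolynomial.eval (Λ.mulVec p) P = MvPolynomial.eval p P) :
    ∃ D : Polynomial ℝ, ∀ p : Fin 4 → ℝ,
      MvPolynomial.eval p P = D.eval (p 0 ^ 2 - p 1 ^ 2 - p 2 ^ 2 - p 3 ^ 2) := by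
  let f : Fin 4 → Polynomial ℝ := ![Polynomial.C (1/2) * (Polynomial.X + 1), 0, 0, Polynomial.C (1/2) * (Polynomial.X - 1)]
  have key : ∀ p : Fin 4 → ℝ, 0 < p 0 - p 3 → MvPolynomial.eval p P =
      (MvPolynomial.aeval f P).eval (p 0 ^ 2 - p 1 ^ 2 - p 2 ^ 2 - p 3 ^ 2) := by
    intro p hv
    rw [eval_curve, ← hinv _ (nullRot_metric (-(p 1) / (p 0 - p 3)) (-(p 2) / (p 0 - p 3)))
      (nullRot_det _ _) (nullRot_zero _ _) p, ← hinv _ (zBoost_metric _ hv) (zBoost_det _ hv)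
      (zBoost_zero _ hv), to_canonical p hv]
    congr 2
    ext i
    fin_cases i <;> simp [f] <;> ring
  refine ⟨MvPolynomial.aeval f P, fun p => ?_⟩
  let g : Fin 4 → Polynomial ℝ := ![Polynomial.X, Polynomial.C (p 1), Polynomial.C (p 2), Polynomial.C (p 3)]
  have hpoly : MvPolynomial.aeval g P = (MvPolynomial.aeval f P).comp
      (Polynomial.X ^ 2 - Polynomial.C (p 1) ^ 2 - Polynomial.C (p 2) ^ 2 - Polynomial.C (p 3) ^ 2) := by
    apply Polynomial.eq_of_infinite_eval_eq
    refine (Set.Ioi_infinite (p 3)).mono ?_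
    intro t ht
    have := key (fun i => (g i).eval t) (by simpa [g] using ht)
    rw [Set.mem_ofPred_eq, eval_curve, this]
    simp [g]
  have h := congrArg (Polynomial.eval (p 0)) hpoly
  rw [eval_curve] at h
  have hg : (fun i => (g i).eval (p 0)) = p := by
    ext i
    fin_cases i <;> simp [g]
  rw [hg] at h
  simpa using h
end

section
/- For every real m > 0 and all p, q : Fin 4 → ℝ with p₀² − p₁² − p₂² − p₃² = m², q₀² − q₁² − q₂² − q₃² = m², p₀ > 0 and q₀ > 0, there exists a matrix Λ in the restricted Lorentz group such that Λ·p = q. In other words, the restricted Lorentz group acts transitively on the upper mass hyperboloid O⁺_m = {p : p₀² − p₁² − p₂² − p₃² = m², p₀ > 0}. -/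
open Matrix

/-- `η u`. -/
noncomputable def lowerVec (u : Fin 4 → ℝ) : Fin 4 → ℝ := ![u 0, -u 1, -u 2, -u 3]

/-- Reflection `x ↦ x - w ⟨u,x⟩ u`, where `w ⟨u,u⟩ = 2`. -/
noncomputable def reflMat (w : ℝ) (u : Fin 4 → ℝ) : Matrix (Fin 4) (Fin 4) ℝ :=
  1 + Matrix.vecMulVec (fun i => -w * u i) (lowerVec u)

lemma reflMat_det (w : ℝ) (u : Fin 4 → ℝ)
    (h : w * (u 0 ^ 2 - u 1 ^ 2 - u 2 ^ 2 - u 3 ^ 2) = 2) : (reflMat w u).det = -1 := by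
  rw [reflMat, Matrix.vecMulVec_eq Unit, Matrix.det_one_add_replicateCol_mul_replicateRow]
  simp only [dotProduct, lowerVec, Fin.sum_univ_four]
  simp
  linear_combination -h

lemma reflMat_lorentz (w : ℝ) (u : Fin 4 → ℝ)
    (h : w * (u 0 ^ 2 - u 1 ^ 2 - u 2 ^ 2 - u 3 ^ 2) = 2) :
    (reflMat w u)ᵀ * minkowskiEta * reflMat w u = minkowskiEta := by
  have key : ∀ i j, ((reflMat w u)ᵀ * minkowskiEta * reflMat w u) i j = minkowskiEta i j := by
    intro i j
    have e : ((reflMat w u)ᵀ * minkowskiEta * reflMat w u) i j - minkowskiEta i j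
        = w * lowerVec u i * lowerVec u j *
          (w * (u 0 ^ 2 - u 1 ^ 2 - u 2 ^ 2 - u 3 ^ 2) - 2) := by
      fin_cases i <;> fin_cases j <;>
        simp [reflMat, minkowskiEta, Matrix.mul_apply, Fin.sum_univ_four, Matrix.vecMulVec_apply,
          lowerVec, Matrix.one_apply, Matrix.diagonal_apply] <;> ring
    rw [h, sub_self, mul_zero] at e
    linarith
  ext i j
  exact key i j

lemma reflMat_mulVec (w : ℝ) (u x : Fin 4 → ℝ) (i : Fin 4) :
    (reflMat w u).mulVec x i
      = x i - w * (u 0 * x 0 - u 1 * x 1 - u 2 * x 2 - u 3 * x 3) * u i := by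
  rw [reflMat, Matrix.add_mulVec, Matrix.one_mulVec]
  simp [Matrix.mulVec, dotProduct, Fin.sum_univ_four, Matrix.vecMulVec_apply, lowerVec]
  ring

/-- The restricted Lorentz group acts transitively on the upper mass hyperboloid
`O⁺_m = {p : p₀² − p₁² − p₂² − p₃² = m², p₀ > 0}`. -/
theorem restricted_lorentz_transitive_on_mass_hyperboloid
    (m : ℝ) (hm : 0 < m) (p q : Fin 4 → ℝ)
    (hp : p 0 ^ 2 - p 1 ^ 2 - p 2 ^ 2 - p 3 ^ 2 = m ^ 2)
    (hq : q 0 ^ 2 - q 1 ^ 2 - q 2 ^ 2 - q 3 ^ 2 = m ^ 2)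
    (hp0 : 0 < p 0) (hq0 : 0 < q 0) :
    ∃ Λ : Matrix (Fin 4) (Fin 4) ℝ,
      Λᵀ * minkowskiEta * Λ = minkowskiEta ∧ Λ.det = 1 ∧ 1 ≤ Λ 0 0 ∧ Λ.mulVec p = q := by
  obtain ⟨s, hs⟩ : ∃ s, s = p 0 * q 0 - p 1 * q 1 - p 2 * q 2 - p 3 * q 3 := ⟨_, rfl⟩
  have hm2 : 0 < m ^ 2 := by positivity
  have hCS : (p 1 * q 1 + p 2 * q 2 + p 3 * q 3) ^ 2
      ≤ (p 0 ^ 2 - m ^ 2) * (q 0 ^ 2 - m ^ 2) := by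
    have e1 : p 0 ^ 2 - m ^ 2 = p 1 ^ 2 + p 2 ^ 2 + p 3 ^ 2 := by linarith
    have e2 : q 0 ^ 2 - m ^ 2 = q 1 ^ 2 + q 2 ^ 2 + q 3 ^ 2 := by linarith
    rw [e1, e2]
    nlinarith [sq_nonneg (p 1 * q 2 - p 2 * q 1), sq_nonneg (p 1 * q 3 - p 3 * q 1),
      sq_nonneg (p 2 * q 3 - p 3 * q 2)]
  have hpm : m ≤ p 0 := by
    refine (abs_le_of_sq_le_sq' ?_ hp0.le).2; nlinarith [sq_nonneg (p 1), sq_nonneg (p 2), sq_nonneg (p 3)]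
  have hqm : m ≤ q 0 := by
    refine (abs_le_of_sq_le_sq' ?_ hq0.le).2; nlinarith [sq_nonneg (q 1), sq_nonneg (q 2), sq_nonneg (q 3)]
  have hsm : m ^ 2 ≤ s := by
    have h1 : 0 ≤ p 0 * q 0 - m ^ 2 := by nlinarith
    have h2 : p 1 * q 1 + p 2 * q 2 + p 3 * q 3 ≤ p 0 * q 0 - m ^ 2 := by
      apply le_of_abs_le
      apply abs_le_of_sq_le_sq _ h1
      nlinarith [mul_nonneg hm2.le (sq_nonneg (p 0 - q 0))]
    linarith
  have hms : 0 < m ^ 2 + s := by linarith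
  have hw : 1 / (m ^ 2 + s) * ((p + q) 0 ^ 2 - (p + q) 1 ^ 2 - (p + q) 2 ^ 2 - (p + q) 3 ^ 2) = 2 := by
    have : (p + q) 0 ^ 2 - (p + q) 1 ^ 2 - (p + q) 2 ^ 2 - (p + q) 3 ^ 2 = 2 * (m ^ 2 + s) := by
      simp only [Pi.add_apply]
      linear_combination hp + hq - 2 * hs
    rw [this]
    field_simp
  have hw' : 2 / m ^ 2 * (p 0 ^ 2 - p 1 ^ 2 - p 2 ^ 2 - p 3 ^ 2) = 2 := by
    rw [hp]
    field_simp
  refine ⟨reflMat (1 / (m ^ 2 + s)) (p + q) * reflMat (2 / m ^ 2) p, ?_, ?_, ?_, ?_⟩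
  · have a := reflMat_lorentz _ _ hw
    have b := reflMat_lorentz _ _ hw'
    rw [Matrix.transpose_mul]
    calc _ = (reflMat (2 / m ^ 2) p)ᵀ * ((reflMat (1 / (m ^ 2 + s)) (p + q))ᵀ * minkowskiEta *
          reflMat (1 / (m ^ 2 + s)) (p + q)) * reflMat (2 / m ^ 2) p := by
            simp only [Matrix.mul_assoc]
      _ = _ := by rw [a, b]
  · rw [Matrix.det_mul, reflMat_det _ _ hw, reflMat_det _ _ hw']
    norm_num
  · have e : (reflMat (1 / (m ^ 2 + s)) (p + q) * reflMat (2 / m ^ 2) p) 0 0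
        = 1 + (2 * p 0 * q 0 * s - m ^ 2 * (p 0 ^ 2 + q 0 ^ 2)) / (m ^ 2 * (m ^ 2 + s)) := by
      have e1 : (reflMat (1 / (m ^ 2 + s)) (p + q) * reflMat (2 / m ^ 2) p) 0 0
        = 1 - 1 / (m ^ 2 + s) * (p 0 + q 0) ^ 2 - 2 / m ^ 2 * p 0 ^ 2
          + 1 / (m ^ 2 + s) * (2 / m ^ 2) * (p 0 + q 0) * p 0 * (m ^ 2 + s) := by
        rw [hs, ← hp]
        simp [reflMat, Matrix.mul_apply, Fin.sum_univ_four, Matrix.vecMulVec_apply,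
          lowerVec, Matrix.one_apply]
        ring
      rw [e1]
      field_simp
      ring
    rw [e]
    have : 0 ≤ 2 * p 0 * q 0 * s - m ^ 2 * (p 0 ^ 2 + q 0 ^ 2) := by
      have h3 : p 1 * q 1 + p 2 * q 2 + p 3 * q 3 = p 0 * q 0 - s := by linarith
      rw [h3] at hCS
      nlinarith
    have := div_nonneg this (mul_pos hm2 hms).le
    linarith
  · rw [← Matrix.mulVec_mulVec]
    have e : (reflMat (2 / m ^ 2) p).mulVec p = -p := by
      ext i
      rw [reflMat_mulVec]
      simp only [Pi.neg_apply]
      linear_combination (-p i) * hw'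
    rw [e]
    ext i
    rw [reflMat_mulVec]
    have h4 : (p + q) 0 * (-p) 0 - (p + q) 1 * (-p) 1 - (p + q) 2 * (-p) 2 - (p + q) 3 * (-p) 3
        = -(m ^ 2 + s) := by
      simp only [Pi.add_apply, Pi.neg_apply]
      linear_combination hs - hp
    rw [h4]
    simp only [Pi.add_apply, Pi.neg_apply]
    field_simp
    ring
end

section
/- Let n be a finite type and M an n×n complex matrix such that det(t • M + m • 1) = det((−t) • M + m • 1) for all complex numbers t and m. Then for every λ ∈ ℂ, the algebraic multiplicity of λ as a root of the characteristic polynomial of M equals the algebraic multiplicity of −λ. In particular, along with each non-null eigenvalue λ the matrix M has the eigenvalue −λ of the same multiplicity. -/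
/-- If `det(t•M + m•1) = det((−t)•M + m•1)` for all complex `t, m`, then the algebraic
multiplicity of any `λ` as a root of the characteristic polynomial of `M` equals that
of `−λ`: along with each non-null eigenvalue `λ`, `M` has the eigenvalue `−λ` of the
same multiplicity. -/
theorem eigenvalues_symmetric_of_det_even {n : Type*} [Fintype n] [DecidableEq n]
    (M : Matrix n n ℂ)
    (h : ∀ t m : ℂ, (t • M + m • (1 : Matrix n n ℂ)).det
      = ((-t) • M + m • (1 : Matrix n n ℂ)).det) :
    ∀ lam : ℂ, Polynomial.rootMultiplicity lam (Matrix.charpoly M)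
      = Polynomial.rootMultiplicity (-lam) (Matrix.charpoly M) := by
  intro lam
  have key : M.charpoly.comp (-Polynomial.X)
      = Polynomial.C ((-1 : ℂ) ^ Fintype.card n) * M.charpoly := by
    apply Polynomial.funext
    intro x
    have e1 : Matrix.scalar n (-x) - M = (-1 : ℂ) • M + (-x) • (1 : Matrix n n ℂ) := by
      rw [Matrix.smul_one_eq_diagonal, Matrix.scalar_apply, neg_one_smul]
      abel
    have e2 : (-(-1 : ℂ)) • M + (-x) • (1 : Matrix n n ℂ) = -(Matrix.scalar n x - M) := by
      rw [neg_smul x, Matrix.smul_one_eq_diagonal, Matrix.scalar_apply, neg_neg, one_smul]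
      abel
    rw [Polynomial.eval_comp, Polynomial.eval_mul, Polynomial.eval_C, Polynomial.eval_neg,
      Polynomial.eval_X, Matrix.eval_charpoly, Matrix.eval_charpoly, e1, h, e2, Matrix.det_neg]
  have hr := congrArg Polynomial.roots key
  rw [Polynomial.roots_comp_neg_X,
    Polynomial.roots_C_mul _ (pow_ne_zero _ (neg_ne_zero.mpr one_ne_zero))] at hr
  rw [← Polynomial.count_roots, ← Polynomial.count_roots,
    ← Multiset.count_map_eq_count' (fun x : ℂ => -x) _ neg_injective lam, hr]
end

section
/- For all natural numbers p and q, the ℂ-vector space of polynomials in six variables x₁, x₂, x₃, y₁, y₂, y₃ that are homogeneous of degree p in (x₁,x₂,x₃), homogeneous of degree q in (y₁,y₂,y₃), and annihilated by the mixed Laplacian ∂²/∂x₁∂y₁ + ∂²/∂x₂∂y₂ + ∂²/∂x₃∂y₃, has dimension N(p,q) = (p+1)(q+1)(p+q+2)/2 over ℂ. -/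
open MvPolynomial

/-- The space of polynomials in six variables `x₁,x₂,x₃` (variables `0,1,2`) and
`y₁,y₂,y₃` (variables `3,4,5`) that are homogeneous of degree `p` in the `x`-variables,
homogeneous of degree `q` in the `y`-variables, and annihilated by the mixed Laplacian
`∂²/∂x₁∂y₁ + ∂²/∂x₂∂y₂ + ∂²/∂x₃∂y₃`. -/
noncomputable def tracelessBisymmetric (p q : ℕ) : Submodule ℂ (MvPolynomial (Fin 6) ℂ) where
  carrier := {P |
    (∀ m ∈ P.support, m 0 + m 1 + m 2 = p ∧ m 3 + m 4 + m 5 = q) ∧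
    pderiv 0 (pderiv 3 P) + pderiv 1 (pderiv 4 P) + pderiv 2 (pderiv 5 P) = 0}
  zero_mem' := by simp
  add_mem' := by
    intro a b ha hb
    refine ⟨fun m hm => ?_, ?_⟩
    · rcases Finset.mem_union.mp (MvPolynomial.support_add hm) with h | h
      · exact ha.1 m h
      · exact hb.1 m h
    · simp only [map_add]
      linear_combination ha.2 + hb.2
  smul_mem' := by
    intro c P hP
    refine ⟨fun m hm => hP.1 m (MvPolynomial.support_smul hm), ?_⟩
    simp only [LinearMap.map_smul, Derivation.map_smul, map_smul]
    rw [← smul_add, ← smul_add, hP.2, smul_zero]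

noncomputable def mk6 (a b c d e f : ℕ) : Fin 6 →₀ ℕ := Finsupp.equivFunOnFinite.symm ![a,b,c,d,e,f]

lemma mk6_eta (m : Fin 6 →₀ ℕ) : m = mk6 (m 0) (m 1) (m 2) (m 3) (m 4) (m 5) := by
  ext i; fin_cases i <;> rfl
@[simp] lemma mk6_0 (a b c d e f : ℕ) : mk6 a b c d e f 0 = a := rfl
@[simp] lemma mk6_1 (a b c d e f : ℕ) : mk6 a b c d e f 1 = b := rfl
@[simp] lemma mk6_2 (a b c d e f : ℕ) : mk6 a b c d e f 2 = c := rfl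
@[simp] lemma mk6_3 (a b c d e f : ℕ) : mk6 a b c d e f 3 = d := rfl
@[simp] lemma mk6_4 (a b c d e f : ℕ) : mk6 a b c d e f 4 = e := rfl
@[simp] lemma mk6_5 (a b c d e f : ℕ) : mk6 a b c d e f 5 = f := rfl

lemma coeff_pd (P : MvPolynomial (Fin 6) ℂ) (i : Fin 6) (m : Fin 6 →₀ ℕ) :
    coeff m (pderiv i P) = (m i + 1) * coeff (m + Finsupp.single i 1) P := by
  induction P using MvPolynomial.induction_on' with
  | add p q hp hq => simp [hp, hq]; ring
  | monomial u a =>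
    rw [pderiv_monomial, coeff_monomial, coeff_monomial]
    by_cases h : u = m + Finsupp.single i 1
    · subst h; simp; ring
    · rw [if_neg h]
      split_ifs with h2
      · by_cases hu : u i = 0
        · simp [hu]
        · exfalso; apply h; rw [← h2]
          rw [tsub_add_cancel_of_le]
          simpa using Nat.one_le_iff_ne_zero.mpr hu
      · simp

lemma coeff_lap (P : MvPolynomial (Fin 6) ℂ) (a b c d e f : ℕ) :
    coeff (mk6 a b c d e f)
      (pderiv 0 (pderiv 3 P) + pderiv 1 (pderiv 4 P) + pderiv 2 (pderiv 5 P)) =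
    (a+1)*(d+1) * coeff (mk6 (a+1) b c (d+1) e f) P
    + (b+1)*(e+1) * coeff (mk6 a (b+1) c d (e+1) f) P
    + (c+1)*(f+1) * coeff (mk6 a b (c+1) d e (f+1)) P := by
  simp only [coeff_add, coeff_pd]
  have h1 : mk6 a b c d e f + Finsupp.single 0 1 + Finsupp.single 3 1 = mk6 (a+1) b c (d+1) e f := by
    ext i; fin_cases i <;> simp 
  have h2 : mk6 a b c d e f + Finsupp.single 1 1 + Finsupp.single 4 1 = mk6 a (b+1) c d (e+1) f := by
    ext i; fin_cases i <;> simp 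
  have h3 : mk6 a b c d e f + Finsupp.single 2 1 + Finsupp.single 5 1 = mk6 a b (c+1) d e (f+1) := by
    ext i; fin_cases i <;> simp 
  rw [h1, h2, h3]
  simp
  ring

/-- Extension of Cauchy data to a solution of the recursion. -/
noncomputable def extB (g : (Fin 6 →₀ ℕ) → ℂ) : ℕ → ℕ → ℕ → ℕ → ℕ → ℕ → ℂ
  | 0, d, b, c, e, f => g (mk6 0 b c d e f)
  | a+1, 0, b, c, e, f => g (mk6 (a+1) b c 0 e f)
  | a+1, d+1, b, c, e, f =>
    -((b+1)*(e+1) * extB g a d (b+1) c (e+1) f + (c+1)*(f+1) * extB g a d b (c+1) e (f+1))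
      / ((a+1)*(d+1))

def bideg (p q : ℕ) (m : Fin 6 →₀ ℕ) : Prop := m 0 + m 1 + m 2 = p ∧ m 3 + m 4 + m 5 = q

def cauchySet (p q : ℕ) : Set (Fin 6 →₀ ℕ) := {m | bideg p q m ∧ (m 0 = 0 ∨ m 3 = 0)}

lemma extB_supp (p q : ℕ) (g : (Fin 6 →₀ ℕ) → ℂ) (hg : ∀ m, ¬ bideg p q m → g m = 0)
    (a d b c e f : ℕ) (h : ¬ bideg p q (mk6 a b c d e f)) : extB g a d b c e f = 0 := by
  induction a generalizing d b c e f with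
  | zero => rw [extB]; exact hg _ h
  | succ a ih =>
    cases d with
    | zero => rw [extB]; exact hg _ h
    | succ d =>
      rw [extB, ih, ih]
      · simp
      all_goals
        simp only [bideg, mk6_0, mk6_1, mk6_2, mk6_3, mk6_4, mk6_5] at h ⊢
        omega

lemma bideg_finite (p q : ℕ) : {m | bideg p q m}.Finite := by
  apply (Set.finite_Iic (mk6 p p p q q q)).subset
  intro m hm
  simp only [bideg, Set.mem_ofPred_eq] at hm
  intro i
  fin_cases i <;> simp <;> omega

noncomputable def resMap (p q : ℕ) (K : Submodule ℂ (MvPolynomial (Fin 6) ℂ)) :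
    K →ₗ[ℂ] (cauchySet p q → ℂ) where
  toFun P s := coeff s.1 P.1
  map_add' := by intros; ext; simp
  map_smul' := by intros; ext; simp

abbrev Idx (p q : ℕ) := (Fin (p+1) × Σ i : Fin (q+1), Fin (i.1+1)) ⊕ ((Σ i : Fin p, Fin (i.1+1)) × Fin (q+1))

noncomputable def idxFun (p q : ℕ) : Idx p q → (Fin 6 →₀ ℕ)
  | .inl (i, j) => mk6 0 i (p - i) (q - j.1) j.2 (j.1 - j.2)
  | .inr (i, j) => mk6 (p - i.1) i.2 (i.1 - i.2) 0 j (q - j)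

lemma idx_card (p q : ℕ) : Fintype.card (Idx p q) = (p + 1) * (q + 1) * (p + q + 2) / 2 := by
  have h : ∀ n : ℕ, 2 * ∑ i : Fin n, (i.1 + 1) = n * (n+1) := by
    intro n
    rw [Fin.sum_univ_eq_sum_range (fun i => i + 1)]
    induction n with
    | zero => simp
    | succ n ih => rw [Finset.sum_range_succ, mul_add, ih]; ring
  simp only [Fintype.card_sum, Fintype.card_prod, Fintype.card_sigma, Fintype.card_fin]
  symm
  apply Nat.div_eq_of_eq_mul_left (by norm_num)
  have h1 := h p
  have h2 := h (q+1)
  zify at h1 h2 ⊢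
  linear_combination -((p:ℤ)+1) * h2 - ((q:ℤ)+1) * h1

lemma idx_inj (p q : ℕ) : Function.Injective (idxFun p q) := by
  intro x y h
  have H := fun i => DFunLike.congr_fun h i
  have h0 := H 0
  have h1 := H 1
  have h3 := H 3
  have h4 := H 4
  rcases x with ⟨⟨i, hi⟩, ⟨j, hj⟩, ⟨k, hk⟩⟩ | ⟨⟨⟨j, hj⟩, ⟨k, hk⟩⟩, ⟨i, hi⟩⟩ <;>
  rcases y with ⟨⟨i', hi'⟩, ⟨j', hj'⟩, ⟨k', hk'⟩⟩ | ⟨⟨⟨j', hj'⟩, ⟨k', hk'⟩⟩, ⟨i', hi'⟩⟩ <;>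
  simp only [idxFun, mk6_0, mk6_1, mk6_3, mk6_4] at h0 h1 h3 h4 hk hk'
  · obtain rfl : j = j' := by omega
    subst h1; subst h4; rfl
  · omega
  · omega
  · obtain rfl : j = j' := by omega
    subst h1; subst h4; rfl

lemma idx_range (p q : ℕ) : Set.range (idxFun p q) = cauchySet p q := by
  ext m
  constructor
  · rintro ⟨⟨⟨i, hi⟩, ⟨j, hj⟩, ⟨k, hk⟩⟩ | ⟨⟨⟨j, hj⟩, ⟨k, hk⟩⟩, ⟨i, hi⟩⟩, rfl⟩ <;>
    simp only at hk
    · refine ⟨⟨?_, ?_⟩, Or.inl rfl⟩ <;>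
        simp only [idxFun, mk6_0, mk6_1, mk6_2, mk6_3, mk6_4, mk6_5] <;> omega
    · refine ⟨⟨?_, ?_⟩, Or.inr rfl⟩ <;>
        simp only [idxFun, mk6_0, mk6_1, mk6_2, mk6_3, mk6_4, mk6_5] <;> omega
  · rintro ⟨⟨h1, h2⟩, h⟩
    by_cases h0 : m 0 = 0
    · refine ⟨.inl (⟨m 1, by omega⟩, ⟨⟨m 4 + m 5, by omega⟩, ⟨m 4, by simp⟩⟩), ?_⟩
      conv_rhs => rw [mk6_eta m]
      simp only [idxFun, mk6_0, mk6_1, mk6_2, mk6_3, mk6_4, mk6_5]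
      congr 1 <;> omega
    · refine ⟨.inr (⟨⟨m 1 + m 2, by omega⟩, ⟨m 1, by simp⟩⟩, ⟨m 4, by omega⟩), ?_⟩
      conv_rhs => rw [mk6_eta m]
      simp only [idxFun, mk6_0, mk6_1, mk6_2, mk6_3, mk6_4, mk6_5]
      congr 1 <;> omega

lemma resMap_inj (p q : ℕ) : Function.Injective (resMap p q (tracelessBisymmetric p q)) := by
  rw [injective_iff_map_eq_zero]
  rintro ⟨P, hP⟩ h
  have key : ∀ a d b c e f, coeff (mk6 a b c d e f) P = 0 := by
    intro a
    have base : ∀ m : Fin 6 →₀ ℕ, m 0 = 0 ∨ m 3 = 0 → coeff m P = 0 := by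
      intro m hm
      by_cases hs : m ∈ P.support
      · exact congrFun h ⟨m, hP.1 m hs, hm⟩
      · simpa using hs
    induction a with
    | zero => intros; exact base _ (Or.inl rfl)
    | succ a ih =>
      intro d b c e f
      cases d with
      | zero => exact base _ (Or.inr rfl)
      | succ d =>
        have := coeff_lap P a b c d e f
        rw [hP.2, ih, ih] at this
        have ha : (a:ℂ) + 1 ≠ 0 := by exact_mod_cast Nat.succ_ne_zero a
        have hd : (d:ℂ) + 1 ≠ 0 := by exact_mod_cast Nat.succ_ne_zero d
        simpa [ha, hd] using this
  ext m
  rw [mk6_eta m]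
  simpa using key _ _ _ _ _ _

lemma resMap_surj (p q : ℕ) : Function.Surjective (resMap p q (tracelessBisymmetric p q)) := by
  classical
  intro g0
  let g : (Fin 6 →₀ ℕ) → ℂ := fun m => if h : m ∈ cauchySet p q then g0 ⟨m, h⟩ else 0
  have hg : ∀ m, ¬ bideg p q m → g m = 0 := by
    intro m hm
    exact dif_neg (fun h => hm h.1)
  let B : (Fin 6 →₀ ℕ) → ℂ := fun m => extB g (m 0) (m 3) (m 1) (m 2) (m 4) (m 5)
  have hB : ∀ m, ¬ bideg p q m → B m = 0 := by
    intro m hm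
    apply extB_supp p q g hg
    rwa [← mk6_eta]
  let P : MvPolynomial (Fin 6) ℂ := ∑ m ∈ (bideg_finite p q).toFinset, monomial m (B m)
  have hc : ∀ m, coeff m P = B m := by
    intro m
    simp only [P, coeff_sum, coeff_monomial, Finset.sum_ite_eq', Set.Finite.mem_toFinset, Set.mem_ofPred_eq]
    split_ifs with h
    · rfl
    · exact (hB m h).symm
  have hP : P ∈ tracelessBisymmetric p q := by
    constructor
    · intro m hm
      by_contra h
      rw [mem_support_iff, hc] at hm
      exact hm (hB m h)
    · ext m
      rw [mk6_eta m, coeff_lap, hc, hc, hc]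
      simp only [B, mk6_0, mk6_1, mk6_2, mk6_3, mk6_4, mk6_5, coeff_zero]
      rw [extB]
      have ha : ((m 0 : ℕ):ℂ) + 1 ≠ 0 := by exact_mod_cast Nat.succ_ne_zero (m 0)
      have hd : ((m 3 : ℕ):ℂ) + 1 ≠ 0 := by exact_mod_cast Nat.succ_ne_zero (m 3)
      field_simp
      ring
  refine ⟨⟨P, hP⟩, ?_⟩
  funext ⟨m, hm⟩
  change coeff m P = _
  rw [hc]
  have hb : B m = g m := by
    conv_rhs => rw [mk6_eta m]
    simp only [B]
    rcases hm.2 with h | h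
    · rw [h, extB]
    · rw [h]
      cases m 0 <;> rw [extB]
  rw [hb]
  exact dif_pos hm

/-- The space `Sym⁰_{(p,q)}` of traceless bisymmetric tensors, which carries the
irreducible representation of `SU(3)` with `p` upper and `q` lower indices, has dimension
`N(p,q) = (p+1)(q+1)(p+q+2)/2`. -/
theorem finrank_tracelessBisymmetric (p q : ℕ) :
    Module.finrank ℂ ↥(tracelessBisymmetric p q) = (p + 1) * (q + 1) * (p + q + 2) / 2 := by
  let e : Idx p q ≃ cauchySet p q :=
    (Equiv.ofInjective _ (idx_inj p q)).trans (Equiv.setCongr (idx_range p q))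
  have : Fintype (cauchySet p q) := Fintype.ofEquiv _ e
  rw [(LinearEquiv.ofBijective _ ⟨resMap_inj p q, resMap_surj p q⟩).finrank_eq,
    Module.finrank_fintype_fun_eq_card, ← Fintype.card_congr e, idx_card]
end
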